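/- Let p, q₁, q₂ be probability density functions on a measurable set Θ ⊆ ℝ^d with p strictly positive, and suppose there exists a constant a > 0 such that q₁(θ) ≥ a and q₂(θ) ≥ a for all θ ∈ Θ. Assume the relevant integrals are finite. Then KL(q₂‖p) − KL(q₁‖p) ≤ ∫ (log q₁(θ) − log p(θ)) · (q₂(θ) − q₁(θ)) dθ + (1/a) · ∫ (q₂(θ) − q₁(θ))² dθ; that is, KL divergence is strongly smooth with the functional gradient ∇KL(q) = log q − log p and constant 1/a. -/

import Mathlib

open MeasureTheory Real

/-- Pointwise form of strong smoothness: the Bregman remainder of `y ↦ y * log (y / p)` at `x`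
is at most `(y - x) + (y - x) ^ 2 / a` when `a ≤ x`. -/
lemma mul_log_div_sub_mul_log_div_le {a p x y : ℝ} (ha : 0 < a) (hp : 0 < p) (hx : a ≤ x)
    (hy : 0 < y) :
    y * log (y / p) - x * log (x / p) ≤
      (log x - log p) * (y - x) + ((y - x) + (1 / a) * (y - x) ^ 2) := by
  have hx0 : 0 < x := ha.trans_le hx
  have hlog : log y - log x ≤ y / x - 1 := by
    rw [← log_div hy.ne' hx0.ne']
    exact log_le_sub_one_of_pos (div_pos hy hx0)
  have hinv : (1 / x) * (y - x) ^ 2 ≤ (1 / a) * (y - x) ^ 2 := by gcongr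
  have hexpand : y * (y / x - 1) = (y - x) + (1 / x) * (y - x) ^ 2 := by
    field_simp
    ring
  rw [log_div hy.ne' hp.ne', log_div hx0.ne' hp.ne']
  linarith [mul_le_mul_of_nonneg_left hlog hy.le]

/-- **Strong smoothness of the KL divergence.**
For probability densities `p, q₁, q₂` on a measurable set `Θ ⊆ ℝ^d`, with `p`
strictly positive on `Θ` and `q₁, q₂ ≥ a > 0` on `Θ`, and assuming the relevant
integrals are finite,
`KL(q₂‖p) − KL(q₁‖p) ≤ ⟨log q₁ − log p, q₂ − q₁⟩ + (1/a)·‖q₂ − q₁‖₂²`. -/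
theorem kl_strongly_smooth
    (d : ℕ) (Θ : Set (Fin d → ℝ)) (hΘ : MeasurableSet Θ)
    (p q₁ q₂ : (Fin d → ℝ) → ℝ) (a : ℝ) (ha : 0 < a)
    (hp_meas : Measurable p) (hq₁_meas : Measurable q₁) (hq₂_meas : Measurable q₂)
    (hp_pos : ∀ θ ∈ Θ, 0 < p θ)
    (hq₁_lb : ∀ θ ∈ Θ, a ≤ q₁ θ) (hq₂_lb : ∀ θ ∈ Θ, a ≤ q₂ θ)
    (hp_one : ∫ θ in Θ, p θ = 1) (hq₁_one : ∫ θ in Θ, q₁ θ = 1)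
    (hq₂_one : ∫ θ in Θ, q₂ θ = 1)
    (hKL₁ : IntegrableOn (fun θ => q₁ θ * Real.log (q₁ θ / p θ)) Θ volume)
    (hKL₂ : IntegrableOn (fun θ => q₂ θ * Real.log (q₂ θ / p θ)) Θ volume)
    (hGrad : IntegrableOn
      (fun θ => (Real.log (q₁ θ) - Real.log (p θ)) * (q₂ θ - q₁ θ)) Θ volume)
    (hL2 : IntegrableOn (fun θ => (q₂ θ - q₁ θ) ^ 2) Θ volume) :
    (∫ θ in Θ, q₂ θ * Real.log (q₂ θ / p θ))
        - ∫ θ in Θ, q₁ θ * Real.log (q₁ θ / p θ)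
      ≤ (∫ θ in Θ, (Real.log (q₁ θ) - Real.log (p θ)) * (q₂ θ - q₁ θ))
        + (1 / a) * ∫ θ in Θ, (q₂ θ - q₁ θ) ^ 2 := by
  have hq₁ : IntegrableOn q₁ Θ volume := .of_integral_ne_zero (by simp [hq₁_one])
  have hq₂ : IntegrableOn q₂ Θ volume := .of_integral_ne_zero (by simp [hq₂_one])
  have hsub : IntegrableOn (fun θ => q₂ θ - q₁ θ) Θ volume := hq₂.sub hq₁
  have hsq : IntegrableOn (fun θ => (1 / a) * (q₂ θ - q₁ θ) ^ 2) Θ volume := hL2.const_mul _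
  have hrem : IntegrableOn (fun θ => (q₂ θ - q₁ θ) + (1 / a) * (q₂ θ - q₁ θ) ^ 2) Θ volume :=
    hsub.add hsq
  have hzero : ∫ θ in Θ, (q₂ θ - q₁ θ) = 0 := by
    rw [integral_sub hq₂ hq₁, hq₁_one, hq₂_one, sub_self]
  have hmono := setIntegral_mono_on (hKL₂.sub hKL₁) (hGrad.add hrem) hΘ fun θ hθ =>
    mul_log_div_sub_mul_log_div_le ha (hp_pos θ hθ) (hq₁_lb θ hθ) (ha.trans_le (hq₂_lb θ hθ))
  rwa [integral_sub' hKL₂ hKL₁, integral_add' hGrad hrem, integral_add hsub hsq, hzero, zero_add,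
    integral_const_mul] at hmono
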